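/- arXiv:2307.06043 — 2 statements merged into one kernel-verified Lean document; each statement's English description precedes it below -/
import Mathlib

section
/- Let A ⟶x B ⟶v C ⟶s A⟦1⟧ be a distinguished triangle in 𝒞, and let y, y' : B ⟶ A be two right inverses of x, i.e. x ∘ y = 𝟙_B and x ∘ y' = 𝟙_B. Then there exists a unique morphism α : B ⟶ C⟦−1⟧ such that y' = y + s' ∘ α. In other words, the set of right inverses of x, when nonempty, is a torsor under the abelian group Hom(B, C⟦−1⟧) acting via α · y = y + s' ∘ α. (This is the affine space structure on the set of right inverses used in the proof of Theorem 6.1.) -/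
open CategoryTheory Category Limits Pretriangulated

/-- Given a distinguished triangle `A ⟶x B ⟶v C ⟶s A⟦1⟧` and two right
inverses `y, y' : B ⟶ A` of `x` (i.e. `y ≫ x = 𝟙 B` and `y' ≫ x = 𝟙 B`), there is a
unique morphism `α : B ⟶ C⟦-1⟧` with `y' = y + α ≫ s'`, where
`s' : C⟦-1⟧ ⟶ A` is `s⟦-1⟧` followed by the canonical iso `(A⟦1⟧)⟦-1⟧ ≅ A`.
Thus the set of right inverses of `x`, when nonempty, is a torsor under `Hom(B, C⟦-1⟧)`. -/
theorem right_inverses_torsor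
    {𝒞 : Type*} [Category 𝒞] [Preadditive 𝒞] [HasZeroObject 𝒞] [HasShift 𝒞 ℤ]
    [∀ n : ℤ, (shiftFunctor 𝒞 n).Additive] [Pretriangulated 𝒞]
    {A B C : 𝒞} (x : A ⟶ B) (v : B ⟶ C) (s : C ⟶ A⟦(1 : ℤ)⟧)
    (hT : Triangle.mk x v s ∈ distTriang 𝒞)
    (s' : C⟦(-1 : ℤ)⟧ ⟶ A)
    (hs' : s' = (shiftFunctor 𝒞 (-1 : ℤ)).map s ≫
      (shiftFunctorCompIsoId 𝒞 (1 : ℤ) (-1 : ℤ) (by omega)).hom.app A)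
    (y y' : B ⟶ A) (hy : y ≫ x = 𝟙 B) (hy' : y' ≫ x = 𝟙 B) :
    ∃! α : B ⟶ C⟦(-1 : ℤ)⟧, y' = y + α ≫ s' := by
  have hv : v = 0 := by
    have h : x ≫ v = 0 := comp_distTriang_mor_zero₁₂ _ hT
    rw [← id_comp v, ← hy, assoc, h, comp_zero]
  have hT' : Triangle.mk (-s') x
      (v ≫ (shiftFunctorCompIsoId 𝒞 (-1 : ℤ) (1 : ℤ) (by omega)).inv.app C) ∈ distTriang 𝒞 := by
    rw [hs']
    exact inv_rot_of_distTriang _ hT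
  have : Mono s' := by
    have h : Mono (-s') := Triangle.mono₁ _ hT' (by rw [hv, zero_comp]; rfl)
    refine ⟨fun a b hab => h.right_cancellation a b ?_⟩
    rw [Preadditive.comp_neg, Preadditive.comp_neg, hab]
  obtain ⟨β, hβ⟩ : ∃ β : B ⟶ C⟦(-1 : ℤ)⟧, y' - y = β ≫ (-s') :=
    Triangle.coyoneda_exact₂ _ hT' (y' - y)
      (show (y' - y) ≫ x = 0 by rw [Preadditive.sub_comp, hy, hy', sub_self])
  have hβ' : y' - y = (-β) ≫ s' := by
    rw [hβ, Preadditive.comp_neg, Preadditive.neg_comp]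
  refine ⟨-β, sub_eq_iff_eq_add'.1 hβ', fun γ hγ => ?_⟩
  rw [← cancel_mono s', ← hβ']
  exact (sub_eq_iff_eq_add'.2 hγ).symm
end

section
/- Let A ⟶x B ⟶v C ⟶s A⟦1⟧ be a distinguished triangle in 𝒞 with v = 0, and let r, r' : A⟦1⟧ ⟶ C be two left inverses of s, i.e. r ∘ s = 𝟙_C and r' ∘ s = 𝟙_C. Then there exists a unique morphism β : B⟦1⟧ ⟶ C such that r' = r + β ∘ x⟦1⟧, where x⟦1⟧ : A⟦1⟧ ⟶ B⟦1⟧ is the shift of x. In other words, the set of left inverses of s, when nonempty, is a torsor under the abelian group Hom(B⟦1⟧, C). (This is the affine space structure on the set of left inverses used for the one-sided localization L_s in Theorem 6.1.) -/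
open CategoryTheory Category Limits Pretriangulated

/-- Given a distinguished triangle `A ⟶x B ⟶v C ⟶s A⟦1⟧` with `v = 0`,
and two left inverses `r, r' : A⟦1⟧ ⟶ C` of `s` (i.e. `s ≫ r = 𝟙 C` and
`s ≫ r' = 𝟙 C`), there is a unique morphism `β : B⟦1⟧ ⟶ C` such that
`r' = r + x⟦1⟧ ≫ β` (i.e. `r' = r + β ∘ x⟦1⟧`). Thus the set of left inverses of
`s`, when nonempty, is a torsor under `Hom(B⟦1⟧, C)`. -/
theorem left_inverses_torsor
    {𝒞 : Type*} [Category 𝒞] [Preadditive 𝒞] [HasZeroObject 𝒞] [HasShift 𝒞 ℤ]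
    [∀ n : ℤ, (shiftFunctor 𝒞 n).Additive] [Pretriangulated 𝒞]
    {A B C : 𝒞} (x : A ⟶ B) (v : B ⟶ C) (s : C ⟶ A⟦(1 : ℤ)⟧)
    (hT : Triangle.mk x v s ∈ distTriang 𝒞) (hv : v = 0)
    (r r' : A⟦(1 : ℤ)⟧ ⟶ C) (hr : s ≫ r = 𝟙 C) (hr' : s ≫ r' = 𝟙 C) :
    ∃! β : B⟦(1 : ℤ)⟧ ⟶ C, r' = r + (shiftFunctor 𝒞 (1 : ℤ)).map x ≫ β := by
  have : Epi x := Triangle.epi₁ _ hT hv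
  obtain ⟨γ, hγ⟩ : ∃ γ : B⟦(1 : ℤ)⟧ ⟶ C,
      r' - r = (-(shiftFunctor 𝒞 (1 : ℤ)).map x) ≫ γ :=
    Triangle.yoneda_exact₂ _ (rot_of_distTriang _ (rot_of_distTriang _ hT)) (r' - r)
      (show s ≫ (r' - r) = 0 by rw [Preadditive.comp_sub, hr, hr', sub_self])
  have hsub : r' = r + (shiftFunctor 𝒞 (1 : ℤ)).map x ≫ (-γ) := by
    rw [Preadditive.comp_neg, ← Preadditive.neg_comp, ← hγ, add_sub_cancel]
  refine ⟨-γ, hsub, fun β hβ => ?_⟩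
  rw [← cancel_epi ((shiftFunctor 𝒞 (1 : ℤ)).map x)]
  exact add_left_cancel (hβ.symm.trans hsub)
end
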